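/- Consider the decentralized primal–dual (Chambolle–Pock) iterations for regularized empirical risk minimization with distributed features. Assume in addition that each loss is ρ-Lipschitz: |ℓᵢ'(u)| ≤ ρ for all u ∈ ℝ and all i ∈ {1,…,n}. Then for every integer T ≥ 1, the ergodic averages θ̄ satisfy (1/n)·Σ_{i=1}^n ℓᵢ((X θ̄)ᵢ) + r(θ̄) ≤ (1/n)·Σ_{i=1}^n ℓᵢ((X θ̂)ᵢ) + r(θ̂) + (2(χ+D)Rρ / ((n/m)^{1/2} T))·√(1 + 2χ²/δ²). -/

import Mathlib

open Matrix Finset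

/-- The ℓ₂→ℓ₂ operator norm (largest singular value) of a real matrix. -/
noncomputable def opNorm {α β : Type*} [Fintype α] [Fintype β] [DecidableEq β]
    (M : Matrix α β ℝ) : ℝ :=
  ‖LinearMap.toContinuousLinearMap (Matrix.toEuclideanLin M)‖

/-- `P` satisfies the four Moore–Penrose conditions for `M`. -/
def IsMoorePenrose {α β : Type*} [Fintype α] [Fintype β]
    (M : Matrix α β ℝ) (P : Matrix β α ℝ) : Prop :=
  M * P * M = M ∧ P * M * P = P ∧ (M * P)ᵀ = M * P ∧ (P * M)ᵀ = P * M

open Classical in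
/-- The Moore–Penrose pseudoinverse. -/
noncomputable def pinv {α β : Type*} [Fintype α] [Fintype β]
    (M : Matrix α β ℝ) : Matrix β α ℝ :=
  if h : ∃ P, IsMoorePenrose M P then h.choose else 0

/-- The three-point inequality for a proximal step. -/
lemma prox_three_point {E : Type*} [NormedAddCommGroup E] [InnerProductSpace ℝ E]
    (f : E → ℝ) (hf : ConvexOn ℝ Set.univ f) (τ : ℝ) (hτ : 0 < τ) (x p : E)
    (hmin : ∀ z, f p + ‖p - x‖ ^ 2 / (2 * τ) ≤ f z + ‖z - x‖ ^ 2 / (2 * τ)) (z : E) :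
    f p + ‖p - x‖ ^ 2 / (2 * τ) + ‖z - p‖ ^ 2 / (2 * τ) ≤ f z + ‖z - x‖ ^ 2 / (2 * τ) := by
  have key : ∀ s : ℝ, 0 < s → s ≤ 1 →
      f p - f z - inner ℝ (p - x) (z - p) / τ ≤ s * (‖z - p‖ ^ 2 / (2 * τ)) := by
    intro s hs hs1
    have h1 := hmin (p + s • (z - p))
    have h2 : f (p + s • (z - p)) ≤ (1 - s) * f p + s * f z := by
      have := hf.2 (Set.mem_univ p) (Set.mem_univ z) (sub_nonneg.2 hs1) hs.le (by ring)
      have e : p + s • (z - p) = (1 - s) • p + s • z := by module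
      rw [e]; simpa using this
    have h3 : ‖p + s • (z - p) - x‖ ^ 2
        = ‖p - x‖ ^ 2 + 2 * s * inner ℝ (p - x) (z - p) + s ^ 2 * ‖z - p‖ ^ 2 := by
      have e : p + s • (z - p) - x = (p - x) + s • (z - p) := by abel
      rw [e, norm_add_sq_real, inner_smul_right, norm_smul, mul_pow, Real.norm_eq_abs, sq_abs]
      ring
    rw [h3] at h1
    have h4 : s * (f p - f z - inner ℝ (p - x) (z - p) / τ) ≤ s * (s * (‖z - p‖ ^ 2 / (2 * τ))) := by
      have e : (‖p - x‖ ^ 2 + 2 * s * inner ℝ (p - x) (z - p) + s ^ 2 * ‖z - p‖ ^ 2) / (2 * τ)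
        = ‖p - x‖ ^ 2 / (2 * τ) + s * (inner ℝ (p - x) (z - p) / τ)
          + s * (s * (‖z - p‖ ^ 2 / (2 * τ))) := by
        field_simp
      rw [e] at h1
      linarith
    exact le_of_mul_le_mul_left h4 hs
  have hlim : f p - f z - inner ℝ (p - x) (z - p) / τ ≤ 0 := by
    by_contra! hc
    set A := f p - f z - inner ℝ (p - x) (z - p) / τ with hA
    set C := ‖z - p‖ ^ 2 / (2 * τ) with hC
    have hC0 : 0 ≤ C := by positivity
    have h := key (min 1 (A / (2 * (C + 1)))) (by positivity) (min_le_left _ _)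
    have h' : min 1 (A / (2 * (C + 1))) * C ≤ A / (2 * (C + 1)) * C :=
      mul_le_mul_of_nonneg_right (min_le_right _ _) hC0
    have h'' : A / (2 * (C + 1)) * C ≤ A / 2 := by
      rw [div_mul_eq_mul_div, div_le_div_iff₀ (by positivity) (by positivity)]
      nlinarith
    linarith
  have e : ‖z - x‖ ^ 2 = ‖p - x‖ ^ 2 + 2 * inner ℝ (p - x) (z - p) + ‖z - p‖ ^ 2 := by
    have e : z - x = (p - x) + (z - p) := by abel
    rw [e, norm_add_sq_real]
  rw [e]
  have e2 : (‖p - x‖ ^ 2 + 2 * inner ℝ (p - x) (z - p) + ‖z - p‖ ^ 2) / (2 * τ)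
    = ‖p - x‖ ^ 2 / (2 * τ) + inner ℝ (p - x) (z - p) / τ + ‖z - p‖ ^ 2 / (2 * τ) := by
    field_simp
  rw [e2]; linarith

section CP
variable {E₁ E₂ F : Type*} [NormedAddCommGroup E₁] [InnerProductSpace ℝ E₁]
  [NormedAddCommGroup E₂] [InnerProductSpace ℝ E₂]
  [NormedAddCommGroup F] [InnerProductSpace ℝ F]

/-- The Chambolle–Pock potential. -/
noncomputable def cpPot (K₁ : E₁ →ₗ[ℝ] F) (K₂ : E₂ →ₗ[ℝ] F) (τ σ : ℝ) (a : E₁) (b : E₂) (y : F) :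
    ℝ :=
  (‖a‖ ^ 2 + ‖b‖ ^ 2) / (2 * τ) + ‖y‖ ^ 2 / (2 * σ) - inner ℝ (K₁ a + K₂ b) y

lemma cpPot_cross (K₁ : E₁ →ₗ[ℝ] F) (K₂ : E₂ →ₗ[ℝ] F) (τ σ c₁ c₂ : ℝ)
    (hτ : 0 < τ) (hσ : 0 < σ) (hc₁ : 0 ≤ c₁) (hc₂ : 0 ≤ c₂)
    (hK₁ : ∀ a, ‖K₁ a‖ ≤ c₁ * ‖a‖) (hK₂ : ∀ a, ‖K₂ a‖ ≤ c₂ * ‖a‖)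
    (hst : τ * σ * (c₁ + c₂) ^ 2 ≤ 1) (a : E₁) (b : E₂) (y : F) :
    |inner ℝ (K₁ a + K₂ b) y| ≤ (‖a‖ ^ 2 + ‖b‖ ^ 2) / (2 * τ) + ‖y‖ ^ 2 / (2 * σ) := by
  have h1 : |inner ℝ (K₁ a + K₂ b) y| ≤ (c₁ * ‖a‖ + c₂ * ‖b‖) * ‖y‖ :=
    (abs_real_inner_le_norm _ _).trans (mul_le_mul_of_nonneg_right
      ((norm_add_le _ _).trans (add_le_add (hK₁ a) (hK₂ b))) (norm_nonneg _))
  refine h1.trans ?_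
  have hN : c₁ * ‖a‖ + c₂ * ‖b‖ ≤ (c₁ + c₂) * Real.sqrt (‖a‖ ^ 2 + ‖b‖ ^ 2) := by
    have ha : ‖a‖ ≤ Real.sqrt (‖a‖ ^ 2 + ‖b‖ ^ 2) := Real.le_sqrt_of_sq_le (by nlinarith [sq_nonneg ‖b‖])
    have hb : ‖b‖ ≤ Real.sqrt (‖a‖ ^ 2 + ‖b‖ ^ 2) := Real.le_sqrt_of_sq_le (by nlinarith [sq_nonneg ‖a‖])
    nlinarith [mul_le_mul_of_nonneg_left ha hc₁, mul_le_mul_of_nonneg_left hb hc₂]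
  have hsq : Real.sqrt (‖a‖ ^ 2 + ‖b‖ ^ 2) ^ 2 = ‖a‖ ^ 2 + ‖b‖ ^ 2 := Real.sq_sqrt (by positivity)
  set N := Real.sqrt (‖a‖ ^ 2 + ‖b‖ ^ 2) with hNdef
  have hN0 : 0 ≤ N := Real.sqrt_nonneg _
  rw [← hsq]
  refine (mul_le_mul_of_nonneg_right hN (norm_nonneg y)).trans ?_
  have e : N ^ 2 / (2 * τ) + ‖y‖ ^ 2 / (2 * σ) = (σ * N ^ 2 + τ * ‖y‖ ^ 2) / (2 * (τ * σ)) := by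
    field_simp
  rw [e, le_div_iff₀ (by positivity)]
  set c := c₁ + c₂
  have hp : 0 < τ * σ := by positivity
  -- multiply by τ
  have h2 : 0 ≤ (τ * σ * c * N - τ * ‖y‖) ^ 2 := sq_nonneg _
  have h3 : τ * σ * (τ * σ * c ^ 2) * N ^ 2 ≤ τ * σ * N ^ 2 := by
    nlinarith [mul_le_mul_of_nonneg_left hst (by positivity : (0:ℝ) ≤ τ * σ * N ^ 2)]
  have h4 : τ * (c * N * ‖y‖ * (2 * (τ * σ))) ≤ τ * (σ * N ^ 2 + τ * ‖y‖ ^ 2) := by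
    nlinarith
  exact le_of_mul_le_mul_left h4 hτ

lemma cp_step (K₁ : E₁ →ₗ[ℝ] F) (K₂ : E₂ →ₗ[ℝ] F) (τ σ c₁ c₂ : ℝ)
    (hτ : 0 < τ) (hσ : 0 < σ) (hc₁ : 0 ≤ c₁) (hc₂ : 0 ≤ c₂)
    (hK₁ : ∀ a, ‖K₁ a‖ ≤ c₁ * ‖a‖) (hK₂ : ∀ a, ‖K₂ a‖ ≤ c₂ * ‖a‖)
    (hst : τ * σ * (c₁ + c₂) ^ 2 ≤ 1)
    (r : E₁ → ℝ) (a a' : E₁) (b b' : E₂) (y y' q : F)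
    (ha : ∀ z, r a' + inner ℝ (K₁ a') y + ‖a' - a‖ ^ 2 / (2 * τ) + ‖z - a'‖ ^ 2 / (2 * τ)
      ≤ r z + inner ℝ (K₁ z) y + ‖z - a‖ ^ 2 / (2 * τ))
    (hb : ∀ u, inner ℝ (K₂ u) y = inner ℝ (b - b') u / τ)
    (hy : y' = y + σ • (K₁ ((2:ℝ) • a' - a) + K₂ ((2:ℝ) • b' - b)) - σ • q)
    (A : E₁) (B : E₂) (Y : F) :
    r a' - r A + inner ℝ (K₁ a' + K₂ b') Y - inner ℝ (K₁ A + K₂ B) y' + inner ℝ q (y' - Y)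
      ≤ cpPot K₁ K₂ τ σ (A - a) (B - b) (Y - y) - cpPot K₁ K₂ τ σ (A - a') (B - b') (Y - y') := by
  have h0 := cpPot_cross K₁ K₂ τ σ c₁ c₂ hτ hσ hc₁ hc₂ hK₁ hK₂ hst (a' - a) (b' - b) (y' - y)
  have h0' := (abs_le.1 h0).2
  have h1 := ha A
  have h2 : inner ℝ (K₂ (b' - B)) y
      = (‖B - b‖ ^ 2 - ‖B - b'‖ ^ 2 - ‖b' - b‖ ^ 2) / (2 * τ) := by
    rw [hb]
    have e : B - b = (B - b') + (b' - b) := by abel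
    rw [e, norm_add_sq_real, ← neg_sub b' b, ← neg_sub B b', inner_neg_neg,
      real_inner_comm (B - b')]
    field_simp
    ring
  have h3 : inner ℝ (q - (K₁ ((2:ℝ) • a' - a) + K₂ ((2:ℝ) • b' - b))) (y' - Y)
      = (‖Y - y‖ ^ 2 - ‖Y - y'‖ ^ 2 - ‖y' - y‖ ^ 2) / (2 * σ) := by
    have e : Y - y = (Y - y') + (y' - y) := by abel
    have e2 : q - (K₁ ((2:ℝ) • a' - a) + K₂ ((2:ℝ) • b' - b)) = (-(1 / σ)) • (y' - y) := by
      rw [hy, add_sub_assoc, add_sub_cancel_left, ← smul_sub, smul_smul]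
      have : -(1 / σ) * σ = -1 := by field_simp
      rw [this]; module
    rw [e2, e, norm_add_sq_real, inner_smul_left, ← neg_sub Y y', inner_neg_right,
      real_inner_comm (Y - y')]
    simp
    field_simp
    ring
  unfold cpPot
  simp only [map_sub, map_smul, inner_sub_left, inner_sub_right, inner_add_left,
    real_inner_smul_left] at *
  have e3 : (‖B - b‖ ^ 2 - ‖B - b'‖ ^ 2 - ‖b' - b‖ ^ 2) / (2 * τ) = ‖B - b‖ ^ 2 / (2 * τ)
     - ‖B - b'‖ ^ 2 / (2 * τ) - ‖b' - b‖ ^ 2 / (2 * τ) := by ring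
  have e4 : (‖Y - y‖ ^ 2 - ‖Y - y'‖ ^ 2 - ‖y' - y‖ ^ 2) / (2 * σ) = ‖Y - y‖ ^ 2 / (2 * σ)
     - ‖Y - y'‖ ^ 2 / (2 * σ) - ‖y' - y‖ ^ 2 / (2 * σ) := by ring
  rw [e3] at h2
  rw [e4] at h3
  simp only [add_div] at *
  linarith

lemma cp_sum (K₁ : E₁ →ₗ[ℝ] F) (K₂ : E₂ →ₗ[ℝ] F) (τ σ c₁ c₂ : ℝ)
    (hτ : 0 < τ) (hσ : 0 < σ) (hc₁ : 0 ≤ c₁) (hc₂ : 0 ≤ c₂)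
    (hK₁ : ∀ a, ‖K₁ a‖ ≤ c₁ * ‖a‖) (hK₂ : ∀ a, ‖K₂ a‖ ≤ c₂ * ‖a‖)
    (hst : τ * σ * (c₁ + c₂) ^ 2 ≤ 1)
    (r : E₁ → ℝ) (hr : ConvexOn ℝ Set.univ r) (a : ℕ → E₁) (b : ℕ → E₂) (y q : ℕ → F)
    (ha0 : a 0 = 0) (hb0 : b 0 = 0) (hy0 : y 0 = 0)
    (ha : ∀ t z, r (a (t + 1)) + inner ℝ (K₁ (a (t + 1))) (y t)
        + ‖a (t + 1) - a t‖ ^ 2 / (2 * τ)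
      ≤ r z + inner ℝ (K₁ z) (y t) + ‖z - a t‖ ^ 2 / (2 * τ))
    (hb : ∀ t u, inner ℝ (K₂ u) (y t) = inner ℝ (b t - b (t + 1)) u / τ)
    (hy : ∀ t, y (t + 1) = y t + σ • (K₁ ((2:ℝ) • a (t + 1) - a t)
      + K₂ ((2:ℝ) • b (t + 1) - b t)) - σ • q (t + 1))
    (A : E₁) (B : E₂) (Y : F) (T : ℕ) :
    ∑ t ∈ Finset.Icc 1 T, (r (a t) - r A + inner ℝ (K₁ (a t) + K₂ (b t)) Y
        - inner ℝ (K₁ A + K₂ B) (y t) + inner ℝ (q t) (y t - Y))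
      ≤ (‖A‖ ^ 2 + ‖B‖ ^ 2) / τ + ‖Y‖ ^ 2 / σ := by
  have main : ∀ T : ℕ, ∑ t ∈ Finset.Icc 1 T, (r (a t) - r A + inner ℝ (K₁ (a t) + K₂ (b t)) Y
        - inner ℝ (K₁ A + K₂ B) (y t) + inner ℝ (q t) (y t - Y))
      ≤ cpPot K₁ K₂ τ σ A B Y - cpPot K₁ K₂ τ σ (A - a T) (B - b T) (Y - y T) := by
    intro T
    induction T with
    | zero => simp [ha0, hb0, hy0]
    | succ t ih =>
      rw [Finset.sum_Icc_succ_top (by omega)]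
      have hconv : ConvexOn ℝ Set.univ (fun z => r z + inner ℝ (K₁ z) (y t)) := by
        refine hr.add ?_
        refine ⟨convex_univ, fun u _ v _ s s' _ _ _ => ?_⟩
        simp [inner_add_left, real_inner_smul_left]
      have hs := cp_step K₁ K₂ τ σ c₁ c₂ hτ hσ hc₁ hc₂ hK₁ hK₂ hst r (a t) (a (t+1)) (b t)
        (b (t+1)) (y t) (y (t+1)) (q (t+1))
        (prox_three_point _ hconv τ hτ (a t) (a (t+1)) (ha t)) (hb t) (hy t) A B Y
      linarith
  refine (main T).trans ?_
  have h1 := cpPot_cross K₁ K₂ τ σ c₁ c₂ hτ hσ hc₁ hc₂ hK₁ hK₂ hst (A - a T) (B - b T) (Y - y T)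
  have h2 := cpPot_cross K₁ K₂ τ σ c₁ c₂ hτ hσ hc₁ hc₂ hK₁ hK₂ hst A B Y
  have h1' := (abs_le.1 h1).2
  have h2' := (abs_le.1 h2).1
  unfold cpPot
  have e : (‖A‖ ^ 2 + ‖B‖ ^ 2) / τ + ‖Y‖ ^ 2 / σ
    = 2 * ((‖A‖ ^ 2 + ‖B‖ ^ 2) / (2 * τ) + ‖Y‖ ^ 2 / (2 * σ)) := by field_simp
  rw [e]
  linarith

end CP

lemma opNorm_sum_sq {α β : Type*} [Fintype α] [Fintype β] [DecidableEq β]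
    (M : Matrix α β ℝ) (c : ℝ) (hM : opNorm M ≤ c) (x : β → ℝ) :
    ∑ i, (M.mulVec x i) ^ 2 ≤ c ^ 2 * ∑ k, x k ^ 2 := by
  have h := (LinearMap.toContinuousLinearMap (Matrix.toEuclideanLin M)).le_opNorm (WithLp.toLp 2 x)
  have h2 : ‖LinearMap.toContinuousLinearMap (Matrix.toEuclideanLin M) (WithLp.toLp 2 x)‖
      ≤ c * ‖(WithLp.toLp 2 x : EuclideanSpace ℝ β)‖ :=
    h.trans (mul_le_mul_of_nonneg_right hM (norm_nonneg _))
  have h3 := pow_le_pow_left₀ (norm_nonneg _) h2 2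
  rw [mul_pow, EuclideanSpace.norm_sq_eq, EuclideanSpace.norm_sq_eq] at h3
  simpa [Matrix.toLpLin_apply] using h3

lemma exists_moorePenrose {α : Type*} [Fintype α] [DecidableEq α] (M : Matrix α α ℝ)
    (hM : M.IsHermitian) : ∃ P, IsMoorePenrose M P := by
  have hs := hM.spectral_theorem
  rw [Unitary.conjStarAlgAut_apply] at hs
  set U : Matrix α α ℝ := (hM.eigenvectorUnitary : Matrix α α ℝ) with hU
  have hUU : star U * U = 1 := Unitary.coe_star_mul_self _
  set e : α → ℝ := hM.eigenvalues with he
  have hs' : M = U * diagonal e * star U := by simpa using hs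
  have hst : star U = Uᵀ := by rw [Matrix.star_eq_conjTranspose, Matrix.conjTranspose_eq_transpose_of_trivial]
  have mul3 : ∀ f g : α → ℝ, (U * diagonal f * star U) * (U * diagonal g * star U)
      = U * diagonal (fun i => f i * g i) * star U := by
    intro f g
    calc _ = U * diagonal f * (star U * U) * diagonal g * star U := by simp only [Matrix.mul_assoc]
      _ = _ := by rw [hUU, Matrix.mul_one, Matrix.mul_assoc U, Matrix.diagonal_mul_diagonal]
  have tr : ∀ f : α → ℝ, (U * diagonal f * star U)ᵀ = U * diagonal f * star U := by
    intro f
    rw [hst]; simp [Matrix.mul_assoc]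
  refine ⟨U * diagonal (fun i => (e i)⁻¹) * star U, ?_, ?_, ?_, ?_⟩
  · rw [hs', mul3, mul3]; congr 3; ext i; simp
  · rw [hs', mul3, mul3]; congr 3; ext i
    by_cases h : e i = 0 <;> simp [h]
  · rw [hs', mul3, tr]
  · rw [hs', mul3, tr]

lemma pinv_spec {α : Type*} [Fintype α] [DecidableEq α] (M : Matrix α α ℝ)
    (hM : M.IsHermitian) : IsMoorePenrose M (pinv M) := by
  unfold pinv
  rw [dif_pos (exists_moorePenrose M hM)]
  exact (exists_moorePenrose M hM).choose_spec

lemma lap_pinv_solve {m : ℕ} (G : SimpleGraph (Fin m)) [DecidableRel G.Adj] (hG : G.Connected)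
    (b : Fin m → ℝ) (hb : ∑ j, b j = 0) :
    (G.lapMatrix ℝ).mulVec ((pinv (G.lapMatrix ℝ)).mulVec b) = b := by
  have hsym : (G.lapMatrix ℝ)ᵀ = G.lapMatrix ℝ := G.isSymm_lapMatrix ℝ
  obtain ⟨h1, h2, h3, h4⟩ := pinv_spec (G.lapMatrix ℝ) (by
    rw [Matrix.IsHermitian, Matrix.conjTranspose_eq_transpose_of_trivial, hsym])
  set L := G.lapMatrix ℝ with hL
  set P := pinv L
  have hone : L.mulVec (fun _ => 1) = 0 := G.lapMatrix_mulVec_const_eq_zero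
  have hLP : L * P = Pᵀ * L := by rw [← h3, Matrix.transpose_mul, hsym]
  rw [Matrix.mulVec_mulVec]
  have hker : L.mulVec (b - (L * P).mulVec b) = 0 := by
    rw [Matrix.mulVec_sub, Matrix.mulVec_mulVec]
    have : L * (L * P) = L := by
      have := congrArg Matrix.transpose h1
      rw [Matrix.transpose_mul, h3, hsym] at this
      exact this
    rw [this, sub_self]
  have hconst := (G.lapMatrix_mulVec_eq_zero_iff_forall_reachable).1 hker
  have hsum : ∑ j, (b - (L * P).mulVec b) j = 0 := by
    simp only [Pi.sub_apply, Finset.sum_sub_distrib, hb, zero_sub, neg_eq_zero]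
    have : ∑ j, (L * P).mulVec b j = (fun _ => (1:ℝ)) ⬝ᵥ (L * P).mulVec b := by
      simp [dotProduct]
    rw [this, Matrix.dotProduct_mulVec, ← Matrix.mulVec_transpose, h3, hLP,
      ← Matrix.mulVec_mulVec, hone]
    simp
  have hz : ∀ j, (b - (L * P).mulVec b) j = 0 := by
    intro j
    have h : ∑ k, (b - (L * P).mulVec b) k = m * (b - (L * P).mulVec b) j := by
      rw [Finset.sum_congr rfl (fun k _ => hconst k j (hG.preconnected k j))]
      simp
      ring
    rw [hsum] at h
    have hm : (m : ℝ) ≠ 0 := by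
      have := j.pos
      positivity
    rcases mul_eq_zero.1 h.symm with h | h
    · exact absurd h hm
    · exact h
  ext j
  have := hz j
  simp only [Pi.sub_apply] at this
  linarith

lemma convex_tangent (f : ℝ → ℝ) (hf : ConvexOn ℝ Set.univ f) (hd : Differentiable ℝ f) (u w : ℝ) :
    f u + deriv f u * (w - u) ≤ f w := by
  rcases lt_trichotomy u w with h | h | h
  · have := hf.deriv_le_slope (Set.mem_univ u) (Set.mem_univ w) h (hd u)
    rw [slope_def_field, le_div_iff₀ (by linarith)] at this
    linarith
  · subst h; simp
  · have := hf.slope_le_deriv (Set.mem_univ w) (Set.mem_univ u) h (hd u)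
    rw [slope_def_field, div_le_iff₀ (by linarith)] at this
    linarith

lemma dual_opt {n : ℕ} (hn : 0 < n) (ℓ : Fin n → ℝ → ℝ) (hℓdiff : ∀ i, Differentiable ℝ (ℓ i))
    (σ : ℝ) (hσ : 0 < σ) (half l : Fin n → ℝ)
    (h : ∀ lam : Fin n → ℝ,
      (1 / (n : ℝ)) * ∑ i, ℓ i (((n : ℝ) / σ) * (half i - l i)) + (∑ i, (l i) ^ 2) / (2 * σ)
        ≤ (1 / (n : ℝ)) * ∑ i, ℓ i (((n : ℝ) / σ) * (half i - lam i))
          + (∑ i, (lam i) ^ 2) / (2 * σ)) (i : Fin n) :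
    l i = deriv (ℓ i) (((n : ℝ) / σ) * (half i - l i)) := by
  have hn' : (n : ℝ) ≠ 0 := by positivity
  set g : Fin n → ℝ := fun i => deriv (ℓ i) (((n : ℝ) / σ) * (half i - l i)) with hg
  set e : Fin n → ℝ := fun i => l i - g i with he
  have hd : HasDerivAt (fun s : ℝ => (1 / (n : ℝ)) * ∑ i, ℓ i (((n : ℝ) / σ) * (half i - (l i + s * e i)))
          + (∑ i, (l i + s * e i) ^ 2) / (2 * σ))
      ((1 / (n : ℝ)) * ∑ i, g i * (((n : ℝ) / σ) * (- e i)) + (∑ i, 2 * l i * e i) / (2 * σ)) 0 := by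
    refine HasDerivAt.add (HasDerivAt.const_mul _ (HasDerivAt.fun_sum fun i _ => ?_))
      (HasDerivAt.div_const (HasDerivAt.fun_sum fun i _ => ?_) _)
    · have h1 : HasDerivAt (fun s : ℝ => ((n : ℝ) / σ) * (half i - (l i + s * e i)))
          (((n : ℝ) / σ) * (- e i)) 0 := by
        have := ((((hasDerivAt_id (0:ℝ)).mul_const (e i)).const_add (l i)).const_sub (half i)).const_mul ((n:ℝ)/σ)
        simpa using this
      have h2 : HasDerivAt (ℓ i) (g i) (((n : ℝ) / σ) * (half i - (l i + 0 * e i))) := by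
        have := (hℓdiff i (((n : ℝ) / σ) * (half i - l i))).hasDerivAt
        simpa [hg] using this
      exact h2.comp (0:ℝ) h1
    · have := ((((hasDerivAt_id (0:ℝ)).mul_const (e i)).const_add (l i))).fun_pow 2
      simpa using this
  have hmin : IsLocalMin (fun s : ℝ => (1 / (n : ℝ)) * ∑ i, ℓ i (((n : ℝ) / σ) * (half i - (l i + s * e i)))
          + (∑ i, (l i + s * e i) ^ 2) / (2 * σ)) 0 := by
    refine Filter.Eventually.of_forall fun s => ?_
    have := h (fun i => l i + s * e i)
    simpa using this
  have h0 := hmin.hasDerivAt_eq_zero hd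
  have h1 : (∑ i, e i ^ 2) / σ = 0 := by
    rw [← h0, Finset.mul_sum, Finset.sum_div, Finset.sum_div, ← Finset.sum_add_distrib]
    refine Finset.sum_congr rfl fun i _ => ?_
    simp only [he]
    field_simp
    ring
  have h2 : ∑ i, e i ^ 2 = 0 := by
    rcases div_eq_zero_iff.1 h1 with h | h
    · exact h
    · exact absurd h hσ.ne'
  have h3 := (Finset.sum_eq_zero_iff_of_nonneg (fun i _ => sq_nonneg (e i))).1 h2 i (Finset.mem_univ i)
  have h4 : e i = 0 := by simpa using h3
  simp only [he] at h4
  linarith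

lemma X_mulVec {m n : ℕ} (d : Fin m → ℕ)
    (Xb : ∀ j, Matrix (Fin n) (Fin (d j)) ℝ)
    (X : Matrix (Fin n) ((j : Fin m) × Fin (d j)) ℝ)
    (hX : ∀ i j k, X i ⟨j, k⟩ = Xb j i k) (θ : ∀ j, Fin (d j) → ℝ) (i : Fin n) :
    X.mulVec (fun p => θ p.1 p.2) i = ∑ j, (Xb j).mulVec (θ j) i := by
  simp [Matrix.mulVec, dotProduct, Fintype.sum_sigma, hX]

lemma X_bound {m n : ℕ} (d : Fin m → ℕ)
    (Xb : ∀ j, Matrix (Fin n) (Fin (d j)) ℝ)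
    (X : Matrix (Fin n) ((j : Fin m) × Fin (d j)) ℝ)
    (hX : ∀ i j k, X i ⟨j, k⟩ = Xb j i k) (χ : ℝ) (hχ : opNorm X ≤ χ) (θ : ∀ j, Fin (d j) → ℝ) :
    ∑ i, (∑ j, (Xb j).mulVec (θ j) i) ^ 2 ≤ χ ^ 2 * ∑ j, ∑ k, θ j k ^ 2 := by
  have := opNorm_sum_sq X χ hχ (fun p => θ p.1 p.2)
  simp only [X_mulVec d Xb X hX] at this
  rwa [Fintype.sum_sigma] at this

lemma Xb_bound {m n : ℕ} (d : Fin m → ℕ)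
    (Xb : ∀ j, Matrix (Fin n) (Fin (d j)) ℝ)
    (X : Matrix (Fin n) ((j : Fin m) × Fin (d j)) ℝ)
    (hX : ∀ i j k, X i ⟨j, k⟩ = Xb j i k) (χ : ℝ) (hχ : opNorm X ≤ χ) (j : Fin m)
    (x : Fin (d j) → ℝ) :
    ∑ i, ((Xb j).mulVec x i) ^ 2 ≤ χ ^ 2 * ∑ k, x k ^ 2 := by
  have h := X_bound d Xb X hX χ hχ (Pi.single j x)
  have e1 : ∀ i, ∑ j', (Xb j').mulVec ((Pi.single j x : ∀ j, Fin (d j) → ℝ) j') i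
      = (Xb j).mulVec x i := by
    intro i
    rw [Finset.sum_eq_single j]
    · simp
    · intro b _ hb; simp [Pi.single_eq_of_ne hb]
    · simp
  have e2 : ∑ j', ∑ k, ((Pi.single j x : ∀ j, Fin (d j) → ℝ) j' k) ^ 2 = ∑ k, x k ^ 2 := by
    rw [Finset.sum_eq_single j]
    · simp
    · intro b _ hb; simp [Pi.single_eq_of_ne hb]
    · simp
  simpa only [e1, e2] using h

lemma lap_apply {m : ℕ} (G : SimpleGraph (Fin m)) [DecidableRel G.Adj] (v : Fin m → ℝ)
    (j : Fin m) : (G.lapMatrix ℝ).mulVec v j = ∑ j' ∈ G.neighborFinset j, (v j - v j') := by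
  rw [G.lapMatrix_mulVec_apply, Finset.sum_sub_distrib]
  simp

/-- Block-diagonal feature operator scaled by `1/n`. -/
noncomputable def opK₁ {m n : ℕ} (d : Fin m → ℕ) (Xb : ∀ j, Matrix (Fin n) (Fin (d j)) ℝ) :
    EuclideanSpace ℝ ((j : Fin m) × Fin (d j)) →ₗ[ℝ] EuclideanSpace ℝ (Fin m × Fin n) where
  toFun a := WithLp.toLp 2 (fun p => (1 / (n : ℝ)) * (Xb p.1).mulVec (fun k => a ⟨p.1, k⟩) p.2)
  map_add' a b := by
    ext p
    simp [Matrix.mulVec, dotProduct, mul_add, Finset.sum_add_distrib]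
  map_smul' c a := by
    ext p
    simp only [Matrix.mulVec, dotProduct, PiLp.smul_apply, smul_eq_mul, RingHom.id_apply,
      Finset.mul_sum]
    exact Finset.sum_congr rfl fun k _ => by ring

/-- Graph Laplacian operator scaled by `1/n`. -/
noncomputable def opK₂ {m : ℕ} (n : ℕ) (L : Matrix (Fin m) (Fin m) ℝ) :
    EuclideanSpace ℝ (Fin m × Fin n) →ₗ[ℝ] EuclideanSpace ℝ (Fin m × Fin n) where
  toFun a := WithLp.toLp 2 (fun p => (1 / (n : ℝ)) * L.mulVec (fun k => a (k, p.2)) p.1)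
  map_add' a b := by
    ext p
    simp [Matrix.mulVec, dotProduct, mul_add, Finset.sum_add_distrib]
  map_smul' c a := by
    ext p
    simp only [Matrix.mulVec, dotProduct, PiLp.smul_apply, smul_eq_mul, RingHom.id_apply,
      Finset.mul_sum]
    exact Finset.sum_congr rfl fun k _ => by ring

lemma opK₁_apply {m n : ℕ} (d : Fin m → ℕ) (Xb : ∀ j, Matrix (Fin n) (Fin (d j)) ℝ)
    (a : EuclideanSpace ℝ ((j : Fin m) × Fin (d j))) (p : Fin m × Fin n) :
    opK₁ d Xb a p = (1 / (n : ℝ)) * (Xb p.1).mulVec (fun k => a ⟨p.1, k⟩) p.2 := rfl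

lemma opK₂_apply {m : ℕ} (n : ℕ) (L : Matrix (Fin m) (Fin m) ℝ)
    (a : EuclideanSpace ℝ (Fin m × Fin n)) (p : Fin m × Fin n) :
    opK₂ n L a p = (1 / (n : ℝ)) * L.mulVec (fun k => a (k, p.2)) p.1 := rfl

lemma opK₁_bound {m n : ℕ} (d : Fin m → ℕ)
    (Xb : ∀ j, Matrix (Fin n) (Fin (d j)) ℝ)
    (X : Matrix (Fin n) ((j : Fin m) × Fin (d j)) ℝ)
    (hX : ∀ i j k, X i ⟨j, k⟩ = Xb j i k) (χ : ℝ) (hχ0 : 0 ≤ χ) (hχ : opNorm X ≤ χ)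
    (a : EuclideanSpace ℝ ((j : Fin m) × Fin (d j))) :
    ‖opK₁ d Xb a‖ ≤ χ / n * ‖a‖ := by
  refine le_of_sq_le_sq ?_ (by positivity)
  rw [mul_pow, EuclideanSpace.norm_sq_eq, EuclideanSpace.norm_sq_eq, Fintype.sum_prod_type,
    Fintype.sum_sigma, Finset.mul_sum]
  refine Finset.sum_le_sum fun j _ => ?_
  have h := Xb_bound d Xb X hX χ hχ j (fun k => a ⟨j, k⟩)
  simp only [opK₁_apply, Real.norm_eq_abs, sq_abs, mul_pow, ← Finset.mul_sum]
  calc _ ≤ (1 / (n:ℝ)) ^ 2 * (χ ^ 2 * ∑ k, a ⟨j, k⟩ ^ 2) := by gcongr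
    _ = _ := by ring

lemma opK₂_bound {m : ℕ} (n : ℕ) (L : Matrix (Fin m) (Fin m) ℝ)
    (D : ℝ) (hD0 : 0 ≤ D) (hD : opNorm L ≤ D)
    (a : EuclideanSpace ℝ (Fin m × Fin n)) :
    ‖opK₂ n L a‖ ≤ D / n * ‖a‖ := by
  refine le_of_sq_le_sq ?_ (by positivity)
  rw [mul_pow, EuclideanSpace.norm_sq_eq, EuclideanSpace.norm_sq_eq, Fintype.sum_prod_type_right,
    Fintype.sum_prod_type_right, Finset.mul_sum]
  refine Finset.sum_le_sum fun i _ => ?_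
  have h := opNorm_sum_sq L D hD (fun k => a (k, i))
  simp only [opK₂_apply, Real.norm_eq_abs, sq_abs, mul_pow, ← Finset.mul_sum]
  calc _ ≤ (1 / (n:ℝ)) ^ 2 * (D ^ 2 * ∑ k, a (k, i) ^ 2) := by gcongr
    _ = _ := by ring

/-- The Chambolle–Pock inequality for the concrete iterates. -/
lemma cp_concrete {m n : ℕ} [NeZero m] (hn : 0 < n)
    (L : Matrix (Fin m) (Fin m) ℝ) (hL : Lᵀ = L)
    (d : Fin m → ℕ)
    (Xb : ∀ j, Matrix (Fin n) (Fin (d j)) ℝ)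
    (X : Matrix (Fin n) ((j : Fin m) × Fin (d j)) ℝ)
    (hX : ∀ i j k, X i ⟨j, k⟩ = Xb j i k)
    (r : ∀ j, (Fin (d j) → ℝ) → ℝ)
    (hrconv : ∀ j, ConvexOn ℝ Set.univ (r j))
    (χ D : ℝ) (hχ : 0 < χ) (hD : 0 < D)
    (hχbound : opNorm X ≤ χ)
    (hDbound : opNorm L ≤ D)
    (σ τ : ℝ) (hσ : 0 < σ) (hτ0 : 0 < τ)
    (hτ : τ = (n : ℝ) ^ 2 / ((χ + D) ^ 2 * σ))
    (θit : ℕ → ∀ j, Fin (d j) → ℝ)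
    (vit : ℕ → Fin m → Fin n → ℝ)
    (lamit : ℕ → Fin m → Fin n → ℝ)
    (hθ0 : ∀ j, θit 0 j = 0) (hv0 : vit 0 = 0) (hlam0 : lamit 0 = 0)
    (hθup : ∀ (t : ℕ) (j : Fin m) (θj : Fin (d j) → ℝ),
      r j (θit (t + 1) j) + (1 / (n : ℝ)) * (lamit t j ⬝ᵥ (Xb j).mulVec (θit (t + 1) j))
          + (∑ k, (θit (t + 1) j k - θit t j k) ^ 2) / (2 * τ)
        ≤ r j θj + (1 / (n : ℝ)) * (lamit t j ⬝ᵥ (Xb j).mulVec θj)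
          + (∑ k, (θj k - θit t j k) ^ 2) / (2 * τ))
    (hvup : ∀ (t : ℕ) (j : Fin m) (i : Fin n),
      vit (t + 1) j i = vit t j i - (τ / (n : ℝ)) * L.mulVec (fun k => lamit t k i) j)
    (w : ℕ → Fin n → ℝ)
    (hlamup : ∀ (t : ℕ) (j : Fin m) (i : Fin n),
      lamit (t + 1) j i = lamit t j i
        + σ * ((1 / (n : ℝ)) * (Xb j).mulVec (fun k => 2 * θit (t + 1) j k - θit t j k) i
          + (1 / (n : ℝ)) * L.mulVec (fun k => 2 * vit (t + 1) k i - vit t k i) j)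
        - σ * (if j = 0 then w (t + 1) i / n else 0))
    (A : ∀ j, Fin (d j) → ℝ) (B Y : Fin m → Fin n → ℝ) (T : ℕ) :
    ∑ t ∈ Finset.Icc 1 T, (∑ j, r j (θit t j) - ∑ j, r j (A j)
        + (1 / (n : ℝ)) * ∑ j, ∑ i, ((Xb j).mulVec (θit t j) i + L.mulVec (fun k => vit t k i) j) * Y j i
        - (1 / (n : ℝ)) * ∑ j, ∑ i, ((Xb j).mulVec (A j) i + L.mulVec (fun k => B k i) j) * lamit t j i
        + (1 / (n : ℝ)) * ∑ i, w t i * (lamit t 0 i - Y 0 i))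
      ≤ (∑ j, ∑ k, A j k ^ 2 + ∑ j, ∑ i, B j i ^ 2) / τ + (∑ j, ∑ i, Y j i ^ 2) / σ := by
  have hn' : (n : ℝ) ≠ 0 := by positivity
  have key := cp_sum (opK₁ d Xb) (opK₂ n L) τ σ (χ / n) (D / n) hτ0 hσ (by positivity)
    (by positivity) (opK₁_bound d Xb X hX χ hχ.le hχbound) (opK₂_bound n L D hD.le hDbound)
    (by rw [hτ]; apply le_of_eq; field_simp)
    (fun a => ∑ j, r j (fun k => a ⟨j, k⟩)) ?_
    (fun t => WithLp.toLp 2 (fun p => θit t p.1 p.2))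
    (fun t => WithLp.toLp 2 (fun p => vit t p.1 p.2))
    (fun t => WithLp.toLp 2 (fun p => lamit t p.1 p.2))
    (fun t => WithLp.toLp 2 (fun p => if p.1 = 0 then w t p.2 / n else 0))
    ?_ ?_ ?_ ?_ ?_ ?_ (WithLp.toLp 2 (fun p => A p.1 p.2))
    (WithLp.toLp 2 (fun p => B p.1 p.2)) (WithLp.toLp 2 (fun p => Y p.1 p.2)) T
  · simp only [EuclideanSpace.norm_sq_eq, PiLp.inner_apply, PiLp.add_apply, PiLp.sub_apply,
      opK₁_apply, opK₂_apply, Real.norm_eq_abs, sq_abs, RCLike.inner_apply, conj_trivial,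
      Fintype.sum_prod_type, Fintype.sum_sigma] at key
    refine le_trans (le_of_eq ?_) key
    refine Finset.sum_congr rfl fun t _ => ?_
    congr 1
    · simp only [Finset.mul_sum]
      congr 1
      · congr 1
        exact Finset.sum_congr rfl fun j _ => Finset.sum_congr rfl fun i _ => by ring
      · exact Finset.sum_congr rfl fun j _ => Finset.sum_congr rfl fun i _ => by ring
    · rw [Finset.sum_eq_single (0 : Fin m)]
      · simp only [if_true, Finset.mul_sum]
        exact Finset.sum_congr rfl fun i _ => by field_simp
      · intro j _ hj; simp [hj]
      · simp
  · refine ⟨convex_univ, fun a _ b _ s s' hs hs' hss => ?_⟩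
    simp only [Finset.smul_sum, ← Finset.sum_add_distrib]
    refine Finset.sum_le_sum fun j _ => ?_
    exact (hrconv j).2 (Set.mem_univ _) (Set.mem_univ _) hs hs' hss
  · ext p; simp [hθ0]
  · ext p; simp [hv0]
  · ext p; simp [hlam0]
  · intro t z
    have h := Finset.sum_le_sum fun j (_ : j ∈ Finset.univ) => hθup t j (fun k => z ⟨j, k⟩)
    simp only [EuclideanSpace.norm_sq_eq, PiLp.inner_apply, PiLp.sub_apply,
      opK₁_apply, Real.norm_eq_abs, sq_abs, RCLike.inner_apply, conj_trivial,
      Fintype.sum_prod_type, Fintype.sum_sigma]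
    simp only [Finset.sum_add_distrib, ← Finset.sum_div, dotProduct, Finset.mul_sum] at h
    refine le_trans (le_of_eq ?_) (h.trans (le_of_eq ?_)) <;> congr 2 <;>
    exact Finset.sum_congr rfl fun j _ => Finset.sum_congr rfl fun i _ => by ring
  · intro t u
    simp only [PiLp.inner_apply, PiLp.sub_apply,
      opK₂_apply, RCLike.inner_apply, conj_trivial, Fintype.sum_prod_type_right, Finset.sum_div]
    refine Finset.sum_congr rfl fun i _ => ?_
    have hs : (fun k => lamit t k i) ⬝ᵥ L.mulVec (fun k => u (k, i))
        = L.mulVec (fun k => lamit t k i) ⬝ᵥ (fun k => u (k, i)) := by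
      rw [Matrix.dotProduct_mulVec, ← Matrix.mulVec_transpose, hL]
    simp only [dotProduct] at hs
    have e1 : ∀ j, u (j, i) * (vit t j i - vit (t + 1) j i) / τ
        = (1 / (n:ℝ)) * (L.mulVec (fun k => lamit t k i) j * u (j, i)) := by
      intro j; rw [hvup]; field_simp; ring
    simp only [e1]
    rw [← Finset.mul_sum, ← hs, Finset.mul_sum]
    exact Finset.sum_congr rfl fun j _ => by ring
  · intro t
    ext p
    simp only [PiLp.add_apply, PiLp.sub_apply, PiLp.smul_apply, smul_eq_mul, opK₁_apply, opK₂_apply]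
    exact hlamup t p.1 p.2

lemma lap_sum_zero {m : ℕ} (G : SimpleGraph (Fin m)) [DecidableRel G.Adj] (v : Fin m → ℝ) :
    ∑ j, (G.lapMatrix ℝ).mulVec v j = 0 := by
  have hsym : (G.lapMatrix ℝ)ᵀ = G.lapMatrix ℝ := G.isSymm_lapMatrix ℝ
  have : ∑ j, (G.lapMatrix ℝ).mulVec v j = (fun _ => (1:ℝ)) ⬝ᵥ (G.lapMatrix ℝ).mulVec v := by
    simp [dotProduct]
  rw [this, Matrix.dotProduct_mulVec, ← Matrix.mulVec_transpose, hsym,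
    G.lapMatrix_mulVec_const_eq_zero]
  simp

lemma b_bound {m n : ℕ} [NeZero m] (d : Fin m → ℕ)
    (Xb : ∀ j, Matrix (Fin n) (Fin (d j)) ℝ)
    (X : Matrix (Fin n) ((j : Fin m) × Fin (d j)) ℝ)
    (hX : ∀ i j k, X i ⟨j, k⟩ = Xb j i k) (χ : ℝ) (hχ : opNorm X ≤ χ) (θ : ∀ j, Fin (d j) → ℝ) :
    ∑ j : Fin m, ∑ i, ((if j = 0 then ∑ j', (Xb j').mulVec (θ j') i else 0)
      - (Xb j).mulVec (θ j) i) ^ 2 ≤ 2 * χ ^ 2 * ∑ j, ∑ k, θ j k ^ 2 := by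
  have h1 : ∀ j : Fin m, ∑ i, ((if j = 0 then ∑ j', (Xb j').mulVec (θ j') i else 0)
      - (Xb j).mulVec (θ j) i) ^ 2 ≤ (if j = 0 then χ ^ 2 * ∑ j, ∑ k, θ j k ^ 2 else 0)
        + χ ^ 2 * ∑ k, θ j k ^ 2 := by
    intro j
    by_cases hj : j = 0
    · subst hj
      simp only [if_true]
      have h := X_bound d Xb X hX χ hχ (Function.update θ 0 0)
      have e1 : ∀ i, ∑ j', (Xb j').mulVec (Function.update θ 0 0 j') i
          = ∑ j', (Xb j').mulVec (θ j') i - (Xb 0).mulVec (θ 0) i := by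
        intro i
        rw [← Finset.add_sum_erase _ _ (Finset.mem_univ (0 : Fin m)),
          ← Finset.add_sum_erase _ (fun j' => (Xb j').mulVec (θ j') i) (Finset.mem_univ (0 : Fin m))]
        simp only [Function.update_self, Matrix.mulVec_zero, Pi.zero_apply, zero_add,
          add_sub_cancel_left]
        refine Finset.sum_congr rfl fun j hj => ?_
        rw [Function.update_of_ne (Finset.ne_of_mem_erase hj)]
      have e2 : ∑ j, ∑ k, (Function.update θ 0 0 j k) ^ 2 ≤ ∑ j, ∑ k, θ j k ^ 2 := by
        refine Finset.sum_le_sum fun j _ => ?_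
        by_cases hj : j = 0
        · subst hj
          simp only [Function.update_self, Pi.zero_apply]
          exact Finset.sum_le_sum fun k _ => by simpa using sq_nonneg (θ 0 k)
        · rw [Function.update_of_ne hj]
      simp only [e1] at h
      have : 0 ≤ χ ^ 2 * ∑ k, θ 0 k ^ 2 := by positivity
      have := mul_le_mul_of_nonneg_left e2 (sq_nonneg χ)
      linarith
    · simp only [hj, if_false, zero_sub, neg_sq, zero_add]
      exact Xb_bound d Xb X hX χ hχ j (θ j)
  refine (Finset.sum_le_sum fun j _ => h1 j).trans (le_of_eq ?_)
  rw [Finset.sum_add_distrib, Finset.sum_ite_eq' Finset.univ (0 : Fin m), ← Finset.mul_sum]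
  simp
  ring

lemma final_const (m n ρ R C S T : ℝ) (hm : 0 < m) (hn : 0 < n) (hρ : 0 < ρ) (hR : 0 < R)
    (hC : 0 < C) (hS : 0 < S) (hT : 0 < T) (σ τ : ℝ)
    (hσ : σ = m ^ ((1 : ℝ) / 2) * n ^ ((3 : ℝ) / 2) * ρ / (C * R * S))
    (hτ : τ = n ^ 2 / (C ^ 2 * σ)) :
    (R ^ 2 * S ^ 2 / τ + m * n * ρ ^ 2 / σ) / T
      = 2 * C * R * ρ / ((n / m) ^ ((1 : ℝ) / 2) * T) * S := by
  have e3 : n ^ ((3 : ℝ) / 2) = n * Real.sqrt n := by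
    rw [Real.sqrt_eq_rpow, show (3:ℝ)/2 = 1 + 1/2 by norm_num, Real.rpow_add hn, Real.rpow_one]
  rw [e3, ← Real.sqrt_eq_rpow] at hσ
  rw [← Real.sqrt_eq_rpow, Real.sqrt_div hn.le]
  have hm2 := Real.sq_sqrt hm.le
  have hn2 := Real.sq_sqrt hn.le
  have hm0 := Real.sqrt_pos.2 hm
  have hn0 := Real.sqrt_pos.2 hn
  set a := Real.sqrt m
  set b := Real.sqrt n
  rw [← hm2, ← hn2]
  rw [← hn2] at hσ hτ
  rw [hτ, hσ]
  field_simp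
  ring

/-- Convergence of the decentralized Chambolle–Pock iterations for Lipschitz losses.
Agents are indexed by `Fin m`, the first agent (who holds the responses) has index `0`.
The ergodic averages `θ̄` of the primal iterates satisfy
`(1/n)Σᵢ ℓᵢ((Xθ̄)ᵢ) + r(θ̄) ≤ (1/n)Σᵢ ℓᵢ((Xθ̂)ᵢ) + r(θ̂)
  + 2(χ+D)Rρ/((n/m)^{1/2}T) · √(1 + 2χ²/δ²)`. -/
theorem stmt_0 {m n : ℕ} [NeZero m] (hn : 0 < n)
    (G : SimpleGraph (Fin m)) [DecidableRel G.Adj] (hG : G.Connected)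
    (d : Fin m → ℕ)
    (Xb : ∀ j, Matrix (Fin n) (Fin (d j)) ℝ)
    (X : Matrix (Fin n) ((j : Fin m) × Fin (d j)) ℝ)
    (hX : ∀ i j k, X i ⟨j, k⟩ = Xb j i k)
    (ℓ : Fin n → ℝ → ℝ)
    (hℓnonneg : ∀ i u, 0 ≤ ℓ i u)
    (hℓconv : ∀ i, ConvexOn ℝ Set.univ (ℓ i))
    (hℓdiff : ∀ i, Differentiable ℝ (ℓ i))
    (r : ∀ j, (Fin (d j) → ℝ) → ℝ)
    (hrconv : ∀ j, ConvexOn ℝ Set.univ (r j))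
    (ρ R χ δ D : ℝ) (hρ : 0 < ρ) (hR : 0 < R) (hχ : 0 < χ) (hδ : 0 < δ) (hD : 0 < D)
    (hlip : ∀ i u, |deriv (ℓ i) u| ≤ ρ)
    -- the empirical risk minimizer and the bounds on the problem data
    (θhat : ∀ j, Fin (d j) → ℝ)
    (hθhat : ∀ θ : ∀ j, Fin (d j) → ℝ,
      (1 / (n : ℝ)) * ∑ i, ℓ i (∑ j, (Xb j).mulVec (θhat j) i) + ∑ j, r j (θhat j)
        ≤ (1 / (n : ℝ)) * ∑ i, ℓ i (∑ j, (Xb j).mulVec (θ j) i) + ∑ j, r j (θ j))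
    (hRbound : Real.sqrt (∑ j, ∑ k, (θhat j k) ^ 2) ≤ R)
    (hχbound : opNorm X ≤ χ)
    (hδbound : opNorm (pinv (G.lapMatrix ℝ)) ≤ δ⁻¹)
    (hDbound : opNorm (G.lapMatrix ℝ) ≤ D)
    -- step sizes
    (σ τ : ℝ)
    (hσ : σ = (m : ℝ) ^ ((1 : ℝ) / 2) * (n : ℝ) ^ ((3 : ℝ) / 2) * ρ
      / ((χ + D) * R * Real.sqrt (1 + 2 * χ ^ 2 / δ ^ 2)))
    (hτ : τ = (n : ℝ) ^ 2 / ((χ + D) ^ 2 * σ))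
    -- the iterates, initialized at zero
    (θit : ℕ → ∀ j, Fin (d j) → ℝ)
    (vit : ℕ → Fin m → Fin n → ℝ)
    (lamit : ℕ → Fin m → Fin n → ℝ)
    (hθ0 : ∀ j, θit 0 j = 0) (hv0 : vit 0 = 0) (hlam0 : lamit 0 = 0)
    -- primal update (i): proximal minimization for θ
    (hθup : ∀ (t : ℕ) (j : Fin m) (θj : Fin (d j) → ℝ),
      r j (θit (t + 1) j) + (1 / (n : ℝ)) * (lamit t j ⬝ᵥ (Xb j).mulVec (θit (t + 1) j))
          + (∑ k, (θit (t + 1) j k - θit t j k) ^ 2) / (2 * τ)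
        ≤ r j θj + (1 / (n : ℝ)) * (lamit t j ⬝ᵥ (Xb j).mulVec θj)
          + (∑ k, (θj k - θit t j k) ^ 2) / (2 * τ))
    -- primal update (ii): v update
    (hvup : ∀ (t : ℕ) (j : Fin m),
      vit (t + 1) j = vit t j
        - (τ / (n : ℝ)) • ∑ j' ∈ G.neighborFinset j, (lamit t j - lamit t j'))
    -- dual update (iii) for agents other than the first
    (hlamup : ∀ (t : ℕ) (j : Fin m), j ≠ 0 →
      lamit (t + 1) j = lamit t j
        + (σ / (n : ℝ)) • (Xb j).mulVec (fun k => 2 * θit (t + 1) j k - θit t j k)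
        + (σ / (n : ℝ)) • ∑ j' ∈ G.neighborFinset j,
            (fun i => 2 * (vit (t + 1) j i - vit (t + 1) j' i) - vit t j i + vit t j' i))
    -- dual update (iv) for the first agent
    (lamhalf : ℕ → Fin n → ℝ)
    (hlamhalf : ∀ t : ℕ,
      lamhalf t = lamit t 0
        + (σ / (n : ℝ)) • (Xb 0).mulVec (fun k => 2 * θit (t + 1) 0 k - θit t 0 k)
        + (σ / (n : ℝ)) • ∑ j' ∈ G.neighborFinset 0,
            (fun i => 2 * (vit (t + 1) 0 i - vit (t + 1) j' i) - vit t 0 i + vit t j' i))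
    (hlam1up : ∀ (t : ℕ) (lam : Fin n → ℝ),
      (1 / (n : ℝ)) * ∑ i, ℓ i (((n : ℝ) / σ) * (lamhalf t i - lamit (t + 1) 0 i))
          + (∑ i, (lamit (t + 1) 0 i) ^ 2) / (2 * σ)
        ≤ (1 / (n : ℝ)) * ∑ i, ℓ i (((n : ℝ) / σ) * (lamhalf t i - lam i))
          + (∑ i, (lam i) ^ 2) / (2 * σ))
    -- ergodic averages over the first T iterations
    (T : ℕ) (hT : 1 ≤ T)
    (θbar : ∀ j, Fin (d j) → ℝ)
    (hθbar : ∀ j k, θbar j k = (1 / (T : ℝ)) * ∑ t ∈ Finset.Icc 1 T, θit t j k) :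
    (1 / (n : ℝ)) * ∑ i, ℓ i (∑ j, (Xb j).mulVec (θbar j) i) + ∑ j, r j (θbar j)
      ≤ (1 / (n : ℝ)) * ∑ i, ℓ i (∑ j, (Xb j).mulVec (θhat j) i) + ∑ j, r j (θhat j)
        + 2 * (χ + D) * R * ρ / (((n : ℝ) / (m : ℝ)) ^ ((1 : ℝ) / 2) * (T : ℝ))
          * Real.sqrt (1 + 2 * χ ^ 2 / δ ^ 2) := by
  have hm0 : 0 < m := Nat.pos_of_ne_zero (NeZero.ne m)
  have hmR : (0 : ℝ) < m := by exact_mod_cast hm0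
  have hnR : (0 : ℝ) < n := by exact_mod_cast hn
  have hTR : (0 : ℝ) < T := by exact_mod_cast (by omega : 0 < T)
  have hS2 : Real.sqrt (1 + 2 * χ ^ 2 / δ ^ 2) ^ 2 = 1 + 2 * χ ^ 2 / δ ^ 2 :=
    Real.sq_sqrt (by positivity)
  have hS : 0 < Real.sqrt (1 + 2 * χ ^ 2 / δ ^ 2) := Real.sqrt_pos.2 (by positivity)
  have hconst := final_const m n ρ R (χ + D) (Real.sqrt (1 + 2 * χ ^ 2 / δ ^ 2)) T hmR hnR hρ hR
    (by positivity) hS hTR σ τ hσ hτ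
  have hσ0 : 0 < σ := by rw [hσ]; positivity
  have hτ0 : 0 < τ := by rw [hτ]; positivity
  have hsym : (G.lapMatrix ℝ)ᵀ = G.lapMatrix ℝ := G.isSymm_lapMatrix ℝ
  rw [← hconst]
  clear hconst
  set w : ℕ → Fin n → ℝ := fun t i => ((n : ℝ) / σ) * (lamhalf (t - 1) i - lamit t 0 i) with hw
  have hopt : ∀ t ∈ Finset.Icc 1 T, ∀ i, lamit t 0 i = deriv (ℓ i) (w t i) := by
    intro t ht i
    obtain ⟨s, rfl⟩ : ∃ s, t = s + 1 := ⟨t - 1, by have := (Finset.mem_Icc.1 ht).1; omega⟩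
    exact dual_opt hn ℓ hℓdiff σ hσ0 (lamhalf s) (lamit (s + 1) 0) (hlam1up s) i
  set u : Fin n → ℝ := fun i => ∑ j, (Xb j).mulVec (θbar j) i with hu
  set uh : Fin n → ℝ := fun i => ∑ j, (Xb j).mulVec (θhat j) i with huh
  set lam : Fin n → ℝ := fun i => deriv (ℓ i) (u i) with hlam
  set b : Fin m → Fin n → ℝ := fun j i => (if j = 0 then uh i else 0) - (Xb j).mulVec (θhat j) i
    with hb
  have hlapv : ∀ t j i, ∑ j' ∈ G.neighborFinset j,
      (2 * (vit (t + 1) j i - vit (t + 1) j' i) - vit t j i + vit t j' i)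
      = (G.lapMatrix ℝ).mulVec (fun k => 2 * vit (t + 1) k i - vit t k i) j := by
    intro t j i
    rw [lap_apply]
    exact Finset.sum_congr rfl fun _ _ => by ring
  have key := cp_concrete hn (G.lapMatrix ℝ) hsym d Xb X hX r hrconv χ D hχ hD hχbound hDbound
    σ τ hσ0 hτ0 hτ θit vit lamit hθ0 hv0 hlam0 hθup
    (by
      intro t j i
      rw [hvup, lap_apply]
      simp)
    w
    (by
      intro t j i
      by_cases hj : j = 0
      · subst hj
        have h := congrFun (hlamhalf t) i
        simp only [Pi.add_apply, Pi.smul_apply, Finset.sum_apply, smul_eq_mul, hlapv] at h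
        have h2 : w (t + 1) i = ((n : ℝ) / σ) * (lamhalf t i - lamit (t + 1) 0 i) := rfl
        rw [if_pos rfl, h2, h]
        field_simp
        ring
      · have h := congrFun (hlamup t j hj) i
        simp only [Pi.add_apply, Pi.smul_apply, Finset.sum_apply, smul_eq_mul, hlapv] at h
        rw [if_neg hj, h]
        ring)
    θhat (fun j i => (pinv (G.lapMatrix ℝ)).mulVec (fun k => b k i) j) (fun _ => lam) T
  -- bound the right-hand side
  have hA : ∑ j, ∑ k, θhat j k ^ 2 ≤ R ^ 2 := (Real.sqrt_le_left hR.le).1 hRbound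
  have hB : ∑ j, ∑ i, ((pinv (G.lapMatrix ℝ)).mulVec (fun k => b k i) j) ^ 2
      ≤ 2 * χ ^ 2 / δ ^ 2 * R ^ 2 := by
    rw [Finset.sum_comm]
    have h1 := Finset.sum_le_sum fun i (_ : i ∈ (Finset.univ : Finset (Fin n))) =>
      opNorm_sum_sq (pinv (G.lapMatrix ℝ)) δ⁻¹ hδbound (fun k => b k i)
    rw [← Finset.mul_sum, Finset.sum_comm (f := fun i j => b j i ^ 2)] at h1
    have h2 := b_bound d Xb X hX χ hχbound θhat
    calc _ ≤ δ⁻¹ ^ 2 * ∑ j, ∑ i, b j i ^ 2 := h1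
      _ ≤ δ⁻¹ ^ 2 * (2 * χ ^ 2 * ∑ j, ∑ k, θhat j k ^ 2) := by
        exact mul_le_mul_of_nonneg_left h2 (by positivity)
      _ ≤ δ⁻¹ ^ 2 * (2 * χ ^ 2 * R ^ 2) := by gcongr
      _ = _ := by field_simp
  have hY : ∑ _j : Fin m, ∑ i, lam i ^ 2 ≤ m * n * ρ ^ 2 := by
    have : ∀ i, lam i ^ 2 ≤ ρ ^ 2 := fun i => sq_le_sq' (abs_le.1 (hlip i (u i))).1
      (abs_le.1 (hlip i (u i))).2
    calc _ ≤ ∑ _j : Fin m, ∑ _i : Fin n, ρ ^ 2 :=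
          Finset.sum_le_sum fun _ _ => Finset.sum_le_sum fun i _ => this i
      _ = _ := by simp; ring
  have hrhs : (∑ j, ∑ k, θhat j k ^ 2
        + ∑ j, ∑ i, ((pinv (G.lapMatrix ℝ)).mulVec (fun k => b k i) j) ^ 2) / τ
        + (∑ _j : Fin m, ∑ i, lam i ^ 2) / σ
      ≤ R ^ 2 * Real.sqrt (1 + 2 * χ ^ 2 / δ ^ 2) ^ 2 / τ + m * n * ρ ^ 2 / σ := by
    rw [hS2]
    gcongr
    linarith
  -- bound the left-hand side
  have hgap : ∀ t ∈ Finset.Icc 1 T,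
      ∑ j, r j (θit t j) - ∑ j, r j (θhat j)
        + (1 / (n : ℝ)) * ∑ i, (lam i * (∑ j, (Xb j).mulVec (θit t j) i - u i) + ℓ i (u i)
            - ℓ i (uh i))
      ≤ (∑ j, r j (θit t j) - ∑ j, r j (θhat j)
        + (1 / (n : ℝ)) * ∑ j, ∑ i, ((Xb j).mulVec (θit t j) i
            + (G.lapMatrix ℝ).mulVec (fun k => vit t k i) j) * lam i
        - (1 / (n : ℝ)) * ∑ j, ∑ i, ((Xb j).mulVec (θhat j) i + (G.lapMatrix ℝ).mulVec
            (fun k => (pinv (G.lapMatrix ℝ)).mulVec (fun k => b k i) k) j) * lamit t j i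
        + (1 / (n : ℝ)) * ∑ i, w t i * (lamit t 0 i - lam i)) := by
    intro t ht
    have e1 : ∑ j, ∑ i, ((Xb j).mulVec (θit t j) i
            + (G.lapMatrix ℝ).mulVec (fun k => vit t k i) j) * lam i
        = ∑ i, (∑ j, (Xb j).mulVec (θit t j) i) * lam i := by
      rw [Finset.sum_comm]
      refine Finset.sum_congr rfl fun i _ => ?_
      rw [← Finset.sum_mul, Finset.sum_add_distrib, lap_sum_zero, add_zero]
    have e2 : ∑ j, ∑ i, ((Xb j).mulVec (θhat j) i + (G.lapMatrix ℝ).mulVec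
            (fun k => (pinv (G.lapMatrix ℝ)).mulVec (fun k => b k i) k) j) * lamit t j i
        = ∑ i, uh i * lamit t 0 i := by
      rw [Finset.sum_comm]
      refine Finset.sum_congr rfl fun i _ => ?_
      have hb0 : ∑ j, b j i = 0 := by
        simp only [hb, Finset.sum_sub_distrib]
        simp [huh]
      have hsol := lap_pinv_solve G hG (fun k => b k i) hb0
      have : ∀ j, ((Xb j).mulVec (θhat j) i + (G.lapMatrix ℝ).mulVec
            (fun k => (pinv (G.lapMatrix ℝ)).mulVec (fun k => b k i) k) j) * lamit t j i
          = if j = 0 then uh i * lamit t j i else 0 := by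
        intro j
        have := congrFun hsol j
        rw [this]
        simp only [hb]
        split_ifs <;> ring
      rw [Finset.sum_congr rfl fun j _ => this j]
      simp
    rw [e1, e2]
    have e3 : (∑ j, r j (θit t j) - ∑ j, r j (θhat j)
        + (1 / (n : ℝ)) * ∑ i, (∑ j, (Xb j).mulVec (θit t j) i) * lam i
        - (1 / (n : ℝ)) * ∑ i, uh i * lamit t 0 i
        + (1 / (n : ℝ)) * ∑ i, w t i * (lamit t 0 i - lam i))
        = ∑ j, r j (θit t j) - ∑ j, r j (θhat j)
        + (1 / (n : ℝ)) * ∑ i, ((∑ j, (Xb j).mulVec (θit t j) i) * lam i - uh i * lamit t 0 i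
          + w t i * (lamit t 0 i - lam i)) := by
      rw [Finset.sum_add_distrib, Finset.sum_sub_distrib]; ring
    rw [e3]
    gcongr with i _
    have t1 := convex_tangent (ℓ i) (hℓconv i) (hℓdiff i) (w t i) (uh i)
    have t2 := convex_tangent (ℓ i) (hℓconv i) (hℓdiff i) (u i) (w t i)
    rw [← hopt t ht i] at t1
    have : deriv (ℓ i) (u i) = lam i := rfl
    rw [this] at t2
    linarith
  have hsum := (Finset.sum_le_sum hgap).trans (key.trans hrhs)
  -- averages
  have hbarfun : ∀ j, θbar j = ∑ t ∈ Finset.Icc 1 T, (1 / (T : ℝ)) • θit t j := by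
    intro j; ext k
    rw [hθbar, Finset.mul_sum]
    simp
  have hu' : ∀ i, ∑ t ∈ Finset.Icc 1 T, ∑ j, (Xb j).mulVec (θit t j) i = T * u i := by
    intro i
    rw [Finset.sum_comm, hu]
    simp only [Finset.mul_sum]
    refine Finset.sum_congr rfl fun j _ => ?_
    rw [hbarfun, Matrix.mulVec_sum]
    simp only [Matrix.mulVec_smul, Finset.sum_apply, Pi.smul_apply, smul_eq_mul, Finset.mul_sum]
    exact Finset.sum_congr rfl fun t _ => by field_simp
  have hr' : T * ∑ j, r j (θbar j) ≤ ∑ t ∈ Finset.Icc 1 T, ∑ j, r j (θit t j) := by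
    rw [Finset.sum_comm, Finset.mul_sum]
    refine Finset.sum_le_sum fun j _ => ?_
    have hJ := (hrconv j).map_sum_le (t := Finset.Icc 1 T) (w := fun _ => 1 / (T : ℝ))
      (p := fun t => θit t j) (fun _ _ => by positivity)
      (by simp; field_simp) (fun _ _ => Set.mem_univ _)
    rw [← hbarfun, ← Finset.smul_sum, smul_eq_mul] at hJ
    calc _ ≤ (T:ℝ) * (1 / T * ∑ t ∈ Finset.Icc 1 T, r j (θit t j)) := by gcongr
      _ = _ := by field_simp
  have hlin : ∑ t ∈ Finset.Icc 1 T, ∑ i, (lam i * (∑ j, (Xb j).mulVec (θit t j) i - u i) + ℓ i (u i)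
            - ℓ i (uh i)) = T * (∑ i, ℓ i (u i) - ∑ i, ℓ i (uh i)) := by
    rw [Finset.sum_comm, ← Finset.sum_sub_distrib, Finset.mul_sum]
    refine Finset.sum_congr rfl fun i _ => ?_
    rw [Finset.sum_sub_distrib, Finset.sum_add_distrib, ← Finset.mul_sum, Finset.sum_sub_distrib,
      hu']
    simp
    ring
  rw [Finset.sum_add_distrib, Finset.sum_sub_distrib, ← Finset.mul_sum, hlin] at hsum
  simp only [Finset.sum_const, Nat.card_Icc, Nat.add_sub_cancel, nsmul_eq_mul] at hsum
  set Q := R ^ 2 * Real.sqrt (1 + 2 * χ ^ 2 / δ ^ 2) ^ 2 / τ + m * n * ρ ^ 2 / σ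
  have hfin : ((1 / (n : ℝ)) * ∑ i, ℓ i (u i) + ∑ j, r j (θbar j))
      - ((1 / (n : ℝ)) * ∑ i, ℓ i (uh i) + ∑ j, r j (θhat j)) ≤ Q / T := by
    rw [le_div_iff₀ hTR]
    have : (1 / (n : ℝ)) * (T * (∑ i, ℓ i (u i) - ∑ i, ℓ i (uh i)))
      = T * ((1 / (n : ℝ)) * ∑ i, ℓ i (u i)) - T * ((1 / (n : ℝ)) * ∑ i, ℓ i (uh i)) := by ring
    rw [this] at hsum
    linarith
  linarith
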